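/- arXiv:2211.00494 — 3 statements merged into one kernel-verified Lean document; each statement's English description precedes it below -/
import Mathlib

section
/- Let I ⊆ ℂ[x,y,z] be the radical ideal of the 12 triple points of the dual Hesse arrangement. Then the polynomial (x^3-y^3)(y^3-z^3)(z^3-x^3) belongs to the third symbolic power I^(3) but not to the ordinary power I^2; in particular I^(3) ⊄ I^2. -/
open MvPolynomial

noncomputable section

/-- `f` vanishes to order at least `m` at the point `p`, i.e. all partial derivatives
of order `< m` of `f` vanish at `p` (we are in characteristic zero). -/
def VanishToOrder (f : MvPolynomial (Fin 3) ℂ) (p : Fin 3 → ℂ) (m : ℕ) : Prop :=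
  ∀ ds : List (Fin 3), ds.length < m →
    eval p (ds.foldr (fun i g => pderiv i g) f) = 0

/-- The affine cone over the 12 triple points of the dual Hesse arrangement:
`(1:0:0)`, `(0:1:0)`, `(0:0:1)` and `(1:εᵃ:εᵇ)` for `a, b ∈ {0,1,2}`. -/
def TripleCone (ε : ℂ) : Set (Fin 3 → ℂ) :=
  {v | ∃ t : ℂ, v = t • ![1, 0, 0] ∨ v = t • ![0, 1, 0] ∨ v = t • ![0, 0, 1] ∨
      ∃ a b : Fin 3, v = t • ![1, ε ^ (a : ℕ), ε ^ (b : ℕ)]}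

/-- The radical ideal of the 12 triple points of the dual Hesse arrangement:
polynomials vanishing on the affine cone over the points. -/
def PtsIdeal (ε : ℂ) : Ideal (MvPolynomial (Fin 3) ℂ) :=
  ⨅ p ∈ TripleCone ε, RingHom.ker (eval p)

theorem aux_cone_hom {g : MvPolynomial (Fin 3) ℂ} {p : Fin 3 → ℂ}
    (h : ∀ t : ℂ, eval (t • p) g = 0) (d : ℕ) :
    ∑ m ∈ g.support with m 0 + (m 1 + m 2) = d,
      coeff m g * (p 0 ^ m 0 * (p 1 ^ m 1 * p 2 ^ m 2)) = 0 := by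
  set q : Polynomial ℂ := ∑ m ∈ g.support,
    Polynomial.monomial (m 0 + (m 1 + m 2)) (coeff m g * (p 0 ^ m 0 * (p 1 ^ m 1 * p 2 ^ m 2))) with hq
  have h0 : q = 0 := by
    apply Polynomial.funext
    intro t
    have := h t
    rw [eval_eq'] at this
    rw [hq, Polynomial.eval_finsetSum, Polynomial.eval_zero, ← this]
    refine Finset.sum_congr rfl fun m _ => ?_
    simp [Fin.prod_univ_three, Polynomial.eval_monomial]
    ring
  have h1 : q.coeff d = 0 := by rw [h0]; simp
  rw [hq, Polynomial.finsetSum_coeff] at h1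
  simp only [Polynomial.coeff_monomial] at h1
  rw [Finset.sum_filter]
  exact h1

def mk3 (i j k : ℕ) : Fin 3 →₀ ℕ := Finsupp.equivFunOnFinite.symm ![i, j, k]

theorem mk3_eta (m : Fin 3 →₀ ℕ) : mk3 (m 0) (m 1) (m 2) = m := by
  ext i; fin_cases i <;> simp [mk3]

theorem mk3_eq (i j k : ℕ) : mk3 i j k = Finsupp.single 0 i + Finsupp.single 1 j + Finsupp.single 2 k := by
  ext a; fin_cases a <;> simp [mk3, Finsupp.single_apply]

theorem mk3_inj {i j k i' j' k' : ℕ} : mk3 i j k = mk3 i' j' k' ↔ i = i' ∧ j = j' ∧ k = k' := by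
  constructor
  · intro h
    have h0 := DFunLike.congr_fun h 0
    have h1 := DFunLike.congr_fun h 1
    have h2 := DFunLike.congr_fun h 2
    simp [mk3] at h0 h1 h2
    exact ⟨h0, h1, h2⟩
  · rintro ⟨rfl, rfl, rfl⟩; rfl

theorem aux_expand {g : MvPolynomial (Fin 3) ℂ} {p : Fin 3 → ℂ}
    (h : ∀ t : ℂ, eval (t • p) g = 0) (d : ℕ) :
    ∑ x ∈ Finset.HasAntidiagonal.antidiagonal d, ∑ y ∈ Finset.HasAntidiagonal.antidiagonal x.2,
      coeff (mk3 x.1 y.1 y.2) g * (p 0 ^ x.1 * (p 1 ^ y.1 * p 2 ^ y.2)) = 0 := by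
  rw [← aux_cone_hom h d, Finset.sum_sigma']
  symm
  refine Finset.sum_of_injOn (fun m => ⟨(m 0, m 1 + m 2), (m 1, m 2)⟩) ?_ ?_ ?_ ?_
  · intro m _ m' _ hm
    simp only [Sigma.mk.injEq, Prod.mk.injEq, heq_eq_eq] at hm
    rw [← mk3_eta m, ← mk3_eta m', mk3_inj]
    tauto
  · intro m hm
    simp at hm ⊢
    exact hm.2
  · rintro ⟨⟨a, b⟩, ⟨c, e⟩⟩ hx hn
    simp only [Finset.mem_sigma, Finset.HasAntidiagonal.mem_antidiagonal] at hx
    obtain ⟨hx1, hx2⟩ := hx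
    subst hx2
    by_contra hc
    apply hn
    refine ⟨mk3 a c e, ?_, ?_⟩
    · simp only [Finset.coe_filter, Set.mem_setOf_eq, mem_support_iff]
      refine ⟨left_ne_zero_of_mul hc, ?_⟩
      simpa [mk3] using hx1
    · simp [mk3]
  · intro m _
    simp only [mk3_eta]

theorem aux_quad {ε : ℂ} (hε : IsPrimitiveRoot ε 3) {a b c : ℂ}
    (h : ∀ u : ℂ, u ^ 3 = 1 → a + b * u + c * u ^ 2 = 0) : a = 0 ∧ b = 0 ∧ c = 0 := by
  have h3 : ε ^ 3 = 1 := hε.pow_eq_one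
  have hne : ε ≠ 1 := hε.ne_one (by norm_num)
  have hs : ε ^ 2 + ε + 1 = 0 := by
    have : (ε - 1) * (ε ^ 2 + ε + 1) = 0 := by linear_combination h3
    exact (mul_eq_zero.mp this).resolve_left (sub_ne_zero.mpr hne)
  have e0 := h 1 (by norm_num)
  have e1 := h ε h3
  have e2 := h (ε ^ 2) (by linear_combination (ε ^ 3 + 1) * h3)
  refine ⟨?_, ?_, ?_⟩
  · linear_combination (1/3) * (e0 + e1 + e2) - (1/3) * (b + c * (ε^2 - ε + 1)) * hs
  · linear_combination (1/3) * (e0 + ε^2 * e1 + ε * e2) - (1/3) * (a + c * (1+ (ε-1) * ε^2)) * hs - (1/3) * b * 2 * h3 - c * (1/3) * (ε ^ 2) *h3 - (c * ε / 3) * (1 - ε) * h3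
  · linear_combination (1/3) * (e0 + ε * e1 + ε ^ 2 * e2) - (1/3) * (a + b * (1+ (ε-1) * ε)) * hs - (1/3) * c * (ε ^3 +2) * h3

theorem aux_quad2 {ε : ℂ} (hε : IsPrimitiveRoot ε 3) {a b c d e f g h k : ℂ}
    (H : ∀ u v : ℂ, u ^ 3 = 1 → v ^ 3 = 1 → (a + b * u + c * u ^ 2) + (d + e * u + f * u ^ 2) * v
      + (g + h * u + k * u ^ 2) * v ^ 2 = 0) :
    a = 0 ∧ b = 0 ∧ c = 0 ∧ d = 0 ∧ e = 0 ∧ f = 0 ∧ g = 0 ∧ h = 0 ∧ k = 0 := by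
  have H1 : ∀ u : ℂ, u ^ 3 = 1 → _ := fun u hu => aux_quad hε (fun v hv => H u v hu hv)
  obtain ⟨h1, h2, h3⟩ := aux_quad hε (fun u hu => (H1 u hu).1)
  obtain ⟨h4, h5, h6⟩ := aux_quad hε (fun u hu => (H1 u hu).2.1)
  obtain ⟨h7, h8, h9⟩ := aux_quad hε (fun u hu => (H1 u hu).2.2)
  exact ⟨h1, h2, h3, h4, h5, h6, h7, h8, h9⟩

structure CoefFacts (g : MvPolynomial (Fin 3) ℂ) : Prop where
  px : ∀ d, coeff (mk3 d 0 0) g = 0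
  py : ∀ d, coeff (mk3 0 d 0) g = 0
  pz : ∀ d, coeff (mk3 0 0 d) g = 0
  c110 : coeff (mk3 1 1 0) g = 0
  c101 : coeff (mk3 1 0 1) g = 0
  c120 : coeff (mk3 1 2 0) g = 0
  c102 : coeff (mk3 1 0 2) g = 0
  c210 : coeff (mk3 2 1 0) g = 0
  c201 : coeff (mk3 2 0 1) g = 0
  c220 : coeff (mk3 2 2 0) g = 0
  c202 : coeff (mk3 2 0 2) g = 0
  c130 : coeff (mk3 1 3 0) g + coeff (mk3 1 0 3) g = 0
  c230 : coeff (mk3 2 3 0) g + coeff (mk3 2 0 3) g = 0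

theorem aux_single (d : ℕ) (F : ℕ → ℕ → ℕ → ℂ) (p : Fin 3 → ℂ) (a : ℕ × ℕ × ℕ)
    (ha : a.1 + (a.2.1 + a.2.2) = d)
    (h : ∀ i j k, i + (j + k) = d → (i, j, k) ≠ a → p 0 ^ i * (p 1 ^ j * p 2 ^ k) = 0) :
    ∑ x ∈ Finset.HasAntidiagonal.antidiagonal d, ∑ y ∈ Finset.HasAntidiagonal.antidiagonal x.2,
      F x.1 y.1 y.2 * (p 0 ^ x.1 * (p 1 ^ y.1 * p 2 ^ y.2)) =
    F a.1 a.2.1 a.2.2 * (p 0 ^ a.1 * (p 1 ^ a.2.1 * p 2 ^ a.2.2)) := by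
  rw [Finset.sum_sigma']
  refine Finset.sum_eq_single (⟨(a.1, a.2.1 + a.2.2), a.2⟩ : (_ : ℕ × ℕ) × ℕ × ℕ) ?_ ?_
  · rintro ⟨⟨i, b⟩, ⟨j, k⟩⟩ hx hn
    simp only [Finset.mem_sigma, Finset.HasAntidiagonal.mem_antidiagonal] at hx
    obtain ⟨hx1, hx2⟩ := hx
    subst hx2
    have := h i j k hx1 (by rintro rfl; exact hn rfl)
    simp only [this, mul_zero]
  · intro hn
    exact absurd (by simpa using ha) hn

theorem coefFacts {ε : ℂ} (hε : IsPrimitiveRoot ε 3) {g : MvPolynomial (Fin 3) ℂ}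
    (hg : g ∈ PtsIdeal ε) : CoefFacts g := by
  have hg' : ∀ p ∈ TripleCone ε, eval p g = 0 := by
    simpa [PtsIdeal, Ideal.mem_iInf, RingHom.mem_ker] using hg
  have H : ∀ u v : ℂ, u ^ 3 = 1 → v ^ 3 = 1 → ∀ t : ℂ, eval (t • ![1, u, v]) g = 0 := by
    intro u v hu hv t
    obtain ⟨i, hi, rfl⟩ := hε.eq_pow_of_pow_eq_one hu
    obtain ⟨j, hj, rfl⟩ := hε.eq_pow_of_pow_eq_one hv
    exact hg' _ ⟨t, Or.inr (Or.inr (Or.inr ⟨⟨i, hi⟩, ⟨j, hj⟩, rfl⟩))⟩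
  have px : ∀ d, coeff (mk3 d 0 0) g = 0 := by
    intro d
    have := aux_expand (fun t => hg' _ ⟨t, Or.inl rfl⟩) d
    rw [aux_single d (fun i j k => coeff (mk3 i j k) g) _ (d, 0, 0) (by simp)] at this
    · simpa using this
    · intro i j k hd hn
      simp only [ne_eq, Prod.mk.injEq] at hn
      simp
      omega
  have py : ∀ d, coeff (mk3 0 d 0) g = 0 := by
    intro d
    have := aux_expand (fun t => hg' _ ⟨t, Or.inr (Or.inl rfl)⟩) d
    rw [aux_single d (fun i j k => coeff (mk3 i j k) g) _ (0, d, 0) (by simp)] at this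
    · simpa using this
    · intro i j k hd hn
      simp only [ne_eq, Prod.mk.injEq] at hn
      simp
      omega
  have pz : ∀ d, coeff (mk3 0 0 d) g = 0 := by
    intro d
    have := aux_expand (fun t => hg' _ ⟨t, Or.inr (Or.inr (Or.inl rfl))⟩) d
    rw [aux_single d (fun i j k => coeff (mk3 i j k) g) _ (0, 0, d) (by simp)] at this
    · simpa using this
    · intro i j k hd hn
      simp only [ne_eq, Prod.mk.injEq] at hn
      simp
      omega
  have E : ∀ d, ∀ u v : ℂ, u ^ 3 = 1 → v ^ 3 = 1 → _ := fun d u v hu hv => aux_expand (H u v hu hv) d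
  have E2 := E 2
  have E3 := E 3
  have E4 := E 4
  have E5 := E 5
  simp [Finset.Nat.antidiagonal_succ, px, py, pz] at E2 E3 E4 E5
  generalize hc : (fun i j k => coeff (mk3 i j k) g) = c at *
  have hc' : ∀ i j k, coeff (mk3 i j k) g = c i j k := fun i j k => by rw [← hc]
  simp only [hc'] at E2 E3 E4 E5 px py pz
  obtain ⟨-, x2, -, x4, -⟩ := aux_quad2 hε (a := 0) (b := c 1 1 0) (c := 0) (d := c 1 0 1)
    (e := c 0 1 1) (f := 0) (g := 0) (h := 0) (k := 0) (fun u v hu hv => by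
      linear_combination E2 u v hu hv)
  obtain ⟨-, y2, y3, y4, -, -, y7, -⟩ := aux_quad2 hε (a := 0) (b := c 2 1 0) (c := c 1 2 0)
    (d := c 2 0 1) (e := c 1 1 1) (f := c 0 2 1) (g := c 1 0 2) (h := c 0 1 2) (k := 0)
    (fun u v hu hv => by linear_combination E3 u v hu hv)
  obtain ⟨z1, -, z3, -, -, -, z7, -⟩ := aux_quad2 hε (a := c 1 3 0 + c 1 0 3)
    (b := c 0 1 3 + c 3 1 0) (c := c 2 2 0) (d := c 0 3 1 + c 3 0 1) (e := c 2 1 1) (f := c 1 2 1)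
    (g := c 2 0 2) (h := c 1 1 2) (k := c 0 2 2)
    (fun u v hu hv => by
      linear_combination E4 u v hu hv - (c 1 3 0 + c 0 3 1 * v) * hu
        - (c 1 0 3 + c 0 1 3 * u) * hv)
  obtain ⟨w1, -⟩ := aux_quad2 hε (a := c 2 3 0 + c 2 0 3)
    (b := c 1 1 3 + c 1 4 0 + c 4 1 0) (c := c 0 2 3 + c 3 2 0) (d := c 1 0 4 + c 1 3 1 + c 4 0 1)
    (e := c 0 1 4 + c 0 4 1 + c 3 1 1) (f := c 2 2 1)
    (g := c 0 3 2 + c 3 0 2) (h := c 2 1 2) (k := c 1 2 2)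
    (fun u v hu hv => by
      linear_combination E5 u v hu hv
        - (c 0 3 2 * v ^ 2 + c 0 4 1 * u * v + c 1 3 1 * v + c 1 4 0 * u + c 2 3 0) * hu
        - (c 0 1 4 * u * v + c 0 2 3 * u ^ 2 + c 1 0 4 * v + c 1 1 3 * u + c 2 0 3) * hv)
  constructor <;> simp only [hc'] <;> assumption

theorem aux_coeff_y {g h : MvPolynomial (Fin 3) ℂ} (hg : CoefFacts g) (hh : CoefFacts h) :
    coeff (mk3 3 6 0) (g * h) = coeff (mk3 1 3 0) g * coeff (mk3 2 3 0) h +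
      coeff (mk3 2 3 0) g * coeff (mk3 1 3 0) h := by
  rw [coeff_mul, ← Finset.sum_pair (a := (mk3 1 3 0, mk3 2 3 0)) (b := (mk3 2 3 0, mk3 1 3 0))
    (f := fun x : (Fin 3 →₀ ℕ) × (Fin 3 →₀ ℕ) => coeff x.1 g * coeff x.2 h)
    (by simp [mk3_inj])]
  symm
  apply Finset.sum_subset
  · intro x hx
    simp only [Finset.mem_insert, Finset.mem_singleton] at hx
    rw [Finset.HasAntidiagonal.mem_antidiagonal]
    rcases hx with rfl | rfl <;> (ext i; fin_cases i <;> simp [mk3])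
  · rintro ⟨m, n⟩ hx hn
    rw [Finset.HasAntidiagonal.mem_antidiagonal] at hx
    have h0 := DFunLike.congr_fun hx 0
    have h1 := DFunLike.congr_fun hx 1
    have h2 := DFunLike.congr_fun hx 2
    simp [mk3] at h0 h1 h2
    rw [← mk3_eta m, ← mk3_eta n] at hn ⊢
    generalize m 0 = a at *
    generalize m 1 = b at *
    generalize n 0 = a' at *
    generalize n 1 = b' at *
    rw [h2.1, h2.2] at hn ⊢
    clear hx h2
    obtain rfl : a' = 3 - a := by omega
    obtain rfl : b' = 6 - b := by omega
    have ha : a ≤ 3 := by omega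
    have hb : b ≤ 6 := by omega
    clear h0 h1
    interval_cases a <;> interval_cases b <;>
      simp [mk3_inj, hg.px, hg.py, hh.px, hh.py, hg.c110, hg.c120, hg.c210, hg.c220,
        hh.c110, hh.c120, hh.c210, hh.c220] at hn ⊢

theorem aux_coeff_z {g h : MvPolynomial (Fin 3) ℂ} (hg : CoefFacts g) (hh : CoefFacts h) :
    coeff (mk3 3 0 6) (g * h) = coeff (mk3 1 0 3) g * coeff (mk3 2 0 3) h +
      coeff (mk3 2 0 3) g * coeff (mk3 1 0 3) h := by
  rw [coeff_mul, ← Finset.sum_pair (a := (mk3 1 0 3, mk3 2 0 3)) (b := (mk3 2 0 3, mk3 1 0 3))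
    (f := fun x : (Fin 3 →₀ ℕ) × (Fin 3 →₀ ℕ) => coeff x.1 g * coeff x.2 h)
    (by simp [mk3_inj])]
  symm
  apply Finset.sum_subset
  · intro x hx
    simp only [Finset.mem_insert, Finset.mem_singleton] at hx
    rw [Finset.HasAntidiagonal.mem_antidiagonal]
    rcases hx with rfl | rfl <;> (ext i; fin_cases i <;> simp [mk3])
  · rintro ⟨m, n⟩ hx hn
    rw [Finset.HasAntidiagonal.mem_antidiagonal] at hx
    have h0 := DFunLike.congr_fun hx 0
    have h1 := DFunLike.congr_fun hx 1
    have h2 := DFunLike.congr_fun hx 2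
    simp [mk3] at h0 h1 h2
    rw [← mk3_eta m, ← mk3_eta n] at hn ⊢
    generalize m 0 = a at *
    generalize m 2 = b at *
    generalize n 0 = a' at *
    generalize n 2 = b' at *
    rw [h1.1, h1.2] at hn ⊢
    clear hx h1
    obtain rfl : a' = 3 - a := by omega
    obtain rfl : b' = 6 - b := by omega
    have ha : a ≤ 3 := by omega
    have hb : b ≤ 6 := by omega
    clear h0 h2
    interval_cases a <;> interval_cases b <;>
      simp [mk3_inj, hg.px, hg.pz, hh.px, hh.pz, hg.c101, hg.c102, hg.c201, hg.c202,
        hh.c101, hh.c102, hh.c201, hh.c202] at hn ⊢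

theorem aux_not_mem {ε : ℂ} (hε : IsPrimitiveRoot ε 3) {f : MvPolynomial (Fin 3) ℂ}
    (hf : f ∈ PtsIdeal ε ^ 2) : coeff (mk3 3 6 0) f = coeff (mk3 3 0 6) f := by
  rw [pow_two] at hf
  refine Submodule.mul_induction_on hf ?_ ?_
  · intro g hg h hh
    have G := coefFacts hε hg
    have K := coefFacts hε hh
    rw [aux_coeff_y G K, aux_coeff_z G K]
    linear_combination coeff (mk3 2 3 0) h * G.c130 - coeff (mk3 1 0 3) g * (-K.c230)
      + coeff (mk3 1 3 0) h * G.c230 - coeff (mk3 2 0 3) g * (-K.c130) - 2 * coeff (mk3 1 0 3) g * K.c230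
       - 2 * coeff (mk3 2 0 3) g * K.c130
  · intro x y hx hy
    rw [coeff_add, coeff_add, hx, hy]

theorem aux_f_coeff :
    coeff (mk3 3 6 0) (((X 0) ^ 3 - (X 1) ^ 3) * ((X 1) ^ 3 - (X 2) ^ 3) * ((X 2) ^ 3 - (X 0) ^ 3)
      : MvPolynomial (Fin 3) ℂ) = 1 ∧
    coeff (mk3 3 0 6) (((X 0) ^ 3 - (X 1) ^ 3) * ((X 1) ^ 3 - (X 2) ^ 3) * ((X 2) ^ 3 - (X 0) ^ 3)
      : MvPolynomial (Fin 3) ℂ) = -1 := by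
  have M : ∀ i j k : ℕ, (X 0 ^ i * X 1 ^ j * X 2 ^ k : MvPolynomial (Fin 3) ℂ)
      = monomial (mk3 i j k) 1 := by
    intro i j k
    rw [mk3_eq, X_pow_eq_monomial, X_pow_eq_monomial, X_pow_eq_monomial, monomial_mul, monomial_mul]
    simp
  have E : (((X 0) ^ 3 - (X 1) ^ 3) * ((X 1) ^ 3 - (X 2) ^ 3) * ((X 2) ^ 3 - (X 0) ^ 3)
      : MvPolynomial (Fin 3) ℂ) = monomial (mk3 6 0 3) 1 - monomial (mk3 6 3 0) 1
        + monomial (mk3 3 6 0) 1 - monomial (mk3 3 0 6) 1 + monomial (mk3 0 3 6) 1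
        - monomial (mk3 0 6 3) 1 := by
    simp only [← M]; ring
  rw [E]
  simp [coeff_monomial, mk3_inj]

theorem aux_pderiv {J : Ideal (MvPolynomial (Fin 3) ℂ)} (i : Fin 3) (n : ℕ) :
    ∀ f ∈ J ^ (n + 1), pderiv i f ∈ J ^ n := by
  induction n with
  | zero => intro f _; simp
  | succ n ih =>
    intro f hf
    rw [pow_succ] at hf
    refine Submodule.mul_induction_on hf ?_ ?_
    · intro a ha b hb
      rw [Derivation.leibniz, smul_eq_mul, smul_eq_mul]
      refine add_mem (Ideal.mul_mem_right _ _ ha) ?_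
      rw [mul_comm, pow_succ]
      exact Ideal.mul_mem_mul (ih a ha) hb
    · intro x y hx hy
      rw [map_add]; exact add_mem hx hy

theorem aux_vanish {f : MvPolynomial (Fin 3) ℂ} {p : Fin 3 → ℂ} {m : ℕ}
    (h : f ∈ (RingHom.ker (eval p)) ^ m) : VanishToOrder f p m := by
  intro ds hds
  have key : ∀ (ds : List (Fin 3)) (k : ℕ), f ∈ (RingHom.ker (eval p)) ^ (k + ds.length) →
      ds.foldr (fun i g => pderiv i g) f ∈ (RingHom.ker (eval p)) ^ k := by
    intro ds
    induction ds with
    | nil => intro k hk; simpa using hk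
    | cons a l ih =>
      intro k hk
      rw [List.foldr_cons]
      apply aux_pderiv
      apply ih
      rw [List.length_cons] at hk
      convert hk using 2
      omega
  have h1 := key ds 1 (Ideal.pow_le_pow_right (by omega) h)
  rw [pow_one] at h1
  exact h1

theorem aux_main_vanish (ε : ℂ) (hε : IsPrimitiveRoot ε 3) : ∀ p ∈ TripleCone ε, VanishToOrder
    (((X 0) ^ 3 - (X 1) ^ 3) * ((X 1) ^ 3 - (X 2) ^ 3) * ((X 2) ^ 3 - (X 0) ^ 3)) p 3 := by
  rintro p ⟨t, hp⟩
  apply aux_vanish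
  have hX : ∀ i, p i = 0 → (X i : MvPolynomial (Fin 3) ℂ) ^ 3 ∈ (RingHom.ker (eval p)) ^ 3 := by
    intro i hi
    apply Ideal.pow_mem_pow
    simp [RingHom.mem_ker, hi]
  rcases hp with hp | hp | hp | ⟨a, b, hp⟩
  · exact Ideal.mul_mem_right _ _ (Ideal.mul_mem_left _ _
      (sub_mem (hX 1 (by simp [hp])) (hX 2 (by simp [hp]))))
  · exact Ideal.mul_mem_left _ _ (sub_mem (hX 2 (by simp [hp])) (hX 0 (by simp [hp])))
  · exact Ideal.mul_mem_right _ _ (Ideal.mul_mem_right _ _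
      (sub_mem (hX 0 (by simp [hp])) (hX 1 (by simp [hp]))))
  · have h3 : ∀ n : ℕ, (ε ^ n) ^ 3 = 1 := by
      intro n; rw [← pow_mul, mul_comm, pow_mul, hε.pow_eq_one, one_pow]
    rw [pow_succ, pow_two]
    refine Ideal.mul_mem_mul (Ideal.mul_mem_mul ?_ ?_) ?_ <;>
      simp [RingHom.mem_ker, hp, mul_pow, h3]

/-- The polynomial `(x³-y³)(y³-z³)(z³-x³)` lies in the third symbolic power `I⁽³⁾`
(it vanishes to order ≥ 3 at each triple point) but not in `I²`; in particular
`I⁽³⁾ ⊄ I²`. -/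
theorem symbolic_cube_not_in_square (ε : ℂ) (hε : IsPrimitiveRoot ε 3) :
    (∀ p ∈ TripleCone ε, VanishToOrder
        (((X 0) ^ 3 - (X 1) ^ 3) * ((X 1) ^ 3 - (X 2) ^ 3) * ((X 2) ^ 3 - (X 0) ^ 3)) p 3) ∧
    (((X 0) ^ 3 - (X 1) ^ 3) * ((X 1) ^ 3 - (X 2) ^ 3) * ((X 2) ^ 3 - (X 0) ^ 3)
        ∉ (PtsIdeal ε) ^ 2) ∧
    ¬ ({f | ∀ p ∈ TripleCone ε, VanishToOrder f p 3} ⊆ (((PtsIdeal ε) ^ 2 : Ideal _) : Set _)) := by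
  have hn : (((X 0) ^ 3 - (X 1) ^ 3) * ((X 1) ^ 3 - (X 2) ^ 3) * ((X 2) ^ 3 - (X 0) ^ 3)
      : MvPolynomial (Fin 3) ℂ) ∉ (PtsIdeal ε) ^ 2 := by
    intro h
    have := aux_not_mem hε h
    rw [aux_f_coeff.1, aux_f_coeff.2] at this
    norm_num at this
  exact ⟨aux_main_vanish ε hε, hn, fun h => hn (h (aux_main_vanish ε hε))⟩
end
end

section
/- Let G = ℤ/6 × ℤ/6 and S the 27 elements with at least one odd coordinate. Call a 3-element subset {g₁,g₂,g₃} ⊆ S 'collinear' if g₁+g₂+g₃ = 0 in G. Then the number of collinear 3-element subsets of S is exactly 81, and each element of S lies in exactly 9 collinear triples. -/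
/-- The 27 elements of `G = ℤ/6 × ℤ/6` having at least one odd coordinate
(the complement of `2G`). -/
def OddPart : Finset (ZMod 6 × ZMod 6) :=
  Finset.univ.filter fun g => Odd g.1.val ∨ Odd g.2.val

lemma oddPart_through (s : ZMod 6 × ZMod 6) (hs : s ∈ OddPart) :
    ((OddPart.powersetCard 3).filter fun T => s ∈ T ∧ T.sum id = 0) =
      (OddPart.filter fun g => -s - g ∈ OddPart).image fun g => {s, g, -s - g} := by
  have key : ∀ s ∈ OddPart, ∀ g ∈ OddPart, -s - g ∈ OddPart →
      s ≠ g ∧ s ≠ -s - g ∧ g ≠ -s - g := by decide +kernel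
  ext T
  simp only [Finset.mem_filter, Finset.mem_powersetCard, Finset.mem_image]
  constructor
  · rintro ⟨⟨hT, hc⟩, hsT, h0⟩
    have h2 : (T.erase s).card = 2 := by rw [Finset.card_erase_of_mem hsT, hc]
    obtain ⟨g, h, hgh, he⟩ := Finset.card_eq_two.1 h2
    have hTe : T = insert s {g, h} := by rw [← he, Finset.insert_erase hsT]
    have hn : s ∉ ({g, h} : Finset (ZMod 6 × ZMod 6)) := by
      rw [← he]; exact Finset.notMem_erase s T
    rw [hTe, Finset.sum_insert hn, Finset.sum_pair hgh] at h0
    simp only [id] at h0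
    have hh : -s - g = h := by
      rw [sub_eq_iff_eq_add, neg_eq_iff_add_eq_zero, add_comm h g]; exact h0
    refine ⟨g, ⟨hT (by simp [hTe]), ?_⟩, ?_⟩
    · rw [hh]; exact hT (by simp [hTe])
    · rw [hh, hTe]
  · rintro ⟨g, ⟨hg, hh⟩, rfl⟩
    obtain ⟨h1, h2, h3⟩ := key s hs g hg hh
    refine ⟨⟨?_, Finset.card_eq_three.2 ⟨_, _, _, h1, h2, h3, rfl⟩⟩, by simp, ?_⟩
    · intro x hx
      simp only [Finset.mem_insert, Finset.mem_singleton] at hx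
      rcases hx with rfl | rfl | rfl <;> assumption
    · rw [Finset.sum_insert (by simp [h1, h2]), Finset.sum_pair h3]
      simp

lemma oddPart_nine (s : ZMod 6 × ZMod 6) (hs : s ∈ OddPart) :
    ((OddPart.powersetCard 3).filter fun T => s ∈ T ∧ T.sum id = 0).card = 9 := by
  rw [oddPart_through s hs]
  revert s
  decide +kernel

/-- There are exactly 81 three-element subsets of `S` summing to `0` ("collinear
triples"), and each element of `S` lies in exactly 9 of them: the `(81₃, 27₉)`
configuration. -/
theorem collinear_triples_configuration :
    ((OddPart.powersetCard 3).filter fun T => T.sum id = 0).card = 81 ∧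
    ∀ s ∈ OddPart,
      ((OddPart.powersetCard 3).filter fun T => s ∈ T ∧ T.sum id = 0).card = 9 := by
  refine ⟨?_, oddPart_nine⟩
  have h27 : OddPart.card = 27 := by decide +kernel
  have h := Finset.card_mul_eq_card_mul (s := OddPart)
    (t := (OddPart.powersetCard 3).filter fun T => T.sum id = 0)
    (fun s T => s ∈ T) (m := 9) (n := 3)
    (fun s hs => by
      rw [← oddPart_nine s hs, Finset.bipartiteAbove, Finset.filter_filter]
      simp only [and_comm])
    (fun T hT => by
      have hT' := Finset.mem_powersetCard.1 (Finset.mem_filter.1 hT).1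
      rw [← hT'.2, Finset.bipartiteBelow, Finset.filter_mem_eq_inter,
        Finset.inter_eq_right.2 hT'.1])
  rw [h27] at h
  omega
end

section
/- Let G = ℤ/6 × ℤ/6 and S the 27 elements with at least one odd coordinate. The number of 6-element subsets of S whose sum lies in the 2-torsion subgroup 3G and which can be partitioned into two disjoint 3-element subsets each summing to 0 in G equals 2268. -/
set_option linter.constructorNameAsVariable false

abbrev GG := ZMod 6 × ZMod 6

def kk (g : GG) : ℕ := 6 * g.1.val + g.2.val

def XX : Finset GG := Finset.univ.filter fun g => Odd g.1.val ∧ ¬ Odd g.2.val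
def YY : Finset GG := Finset.univ.filter fun g => ¬ Odd g.1.val ∧ Odd g.2.val
def ZZ : Finset GG := Finset.univ.filter fun g => Odd g.1.val ∧ Odd g.2.val

def SS : Finset ((GG × GG) × (GG × GG)) :=
  ((XX ×ˢ YY) ×ˢ (XX ×ˢ YY)).filter fun p =>
    kk p.1.1 < kk p.2.1 ∧ p.1.2 ≠ p.2.2 ∧ p.1.1 + p.1.2 ≠ p.2.1 + p.2.2

def tri (p : GG × GG) : Finset GG := {p.1, p.2, -(p.1 + p.2)}

def ff (p : (GG × GG) × (GG × GG)) : Finset GG := tri p.1 ∪ tri p.2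

lemma SS_card : SS.card = 2268 := by decide +kernel

lemma kk_inj : ∀ x y : GG, kk x = kk y → x = y := by decide +kernel

lemma XY_Z : ∀ x ∈ XX, ∀ y ∈ YY, -(x + y) ∈ ZZ := by decide +kernel

lemma X_odd {x} (h : x ∈ XX) : x ∈ OddPart := by
  simp only [XX, OddPart, Finset.mem_filter] at *; tauto
lemma Y_odd {x} (h : x ∈ YY) : x ∈ OddPart := by
  simp only [YY, OddPart, Finset.mem_filter] at *; tauto
lemma Z_odd {x} (h : x ∈ ZZ) : x ∈ OddPart := by
  simp only [ZZ, OddPart, Finset.mem_filter] at *; tauto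
lemma XY_ne {x y} (h : x ∈ XX) (h' : y ∈ YY) : x ≠ y := by
  rintro rfl; simp only [XX, YY, Finset.mem_filter] at *; tauto
lemma XZ_ne {x y} (h : x ∈ XX) (h' : y ∈ ZZ) : x ≠ y := by
  rintro rfl; simp only [XX, ZZ, Finset.mem_filter] at *; tauto
lemma YZ_ne {x y} (h : x ∈ YY) (h' : y ∈ ZZ) : x ≠ y := by
  rintro rfl; simp only [YY, ZZ, Finset.mem_filter] at *; tauto

lemma classes : ∀ x ∈ OddPart, ∀ y ∈ OddPart, -(x + y) ∈ OddPart →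
    (x ∈ XX ∧ y ∈ YY) ∨ (y ∈ XX ∧ x ∈ YY) ∨ (x ∈ XX ∧ -(x + y) ∈ YY) ∨
    (-(x + y) ∈ XX ∧ x ∈ YY) ∨ (y ∈ XX ∧ -(x + y) ∈ YY) ∨ (-(x + y) ∈ XX ∧ y ∈ YY) := by
  decide +kernel

lemma tri_of (A : Finset GG) (hA : A ⊆ OddPart) (hc : A.card = 3) (hs : A.sum id = 0) :
    ∃ p : GG × GG, p.1 ∈ XX ∧ p.2 ∈ YY ∧ A = tri p := by
  obtain ⟨x, y, z, hxy, hxz, hyz, rfl⟩ := Finset.card_eq_three.1 hc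
  have hz : z = -(x + y) := by
    rw [Finset.sum_insert (by simp [hxy, hxz]), Finset.sum_insert (by simp [hyz]),
      Finset.sum_singleton] at hs
    simp only [id] at hs
    rw [← add_assoc] at hs
    exact (neg_eq_of_add_eq_zero_right hs).symm
  have hx' := hA (show x ∈ _ by simp)
  have hy' := hA (show y ∈ _ by simp)
  have hz' := hA (show z ∈ _ by simp)
  have key := classes x hx' y hy' (hz ▸ hz')
  rw [← hz] at key
  have e1 : -(y + x) = z := by rw [hz]; abel
  have e2 : -(x + z) = y := by rw [hz]; abel
  have e3 : -(z + x) = y := by rw [hz]; abel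
  have e4 : -(y + z) = x := by rw [hz]; abel
  have e5 : -(z + y) = x := by rw [hz]; abel
  rcases key with h | h | h | h | h | h
  · exact ⟨(x, y), h.1, h.2, by simp only [tri, ← hz]⟩
  · exact ⟨(y, x), h.1, h.2, by simp only [tri, e1]; grind⟩
  · exact ⟨(x, z), h.1, h.2, by simp only [tri, e2]; grind⟩
  · exact ⟨(z, x), h.1, h.2, by simp only [tri, e3]; grind⟩
  · exact ⟨(y, z), h.1, h.2, by simp only [tri, e4]; grind⟩
  · exact ⟨(z, y), h.1, h.2, by simp only [tri, e5]; grind⟩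

lemma tri_sub {p : GG × GG} (h1 : p.1 ∈ XX) (h2 : p.2 ∈ YY) : tri p ⊆ OddPart := by
  intro x hx
  simp only [tri, Finset.mem_insert, Finset.mem_singleton] at hx
  rcases hx with rfl | rfl | rfl
  · exact X_odd h1
  · exact Y_odd h2
  · exact Z_odd (XY_Z _ h1 _ h2)

lemma tri_card {p : GG × GG} (h1 : p.1 ∈ XX) (h2 : p.2 ∈ YY) : (tri p).card = 3 := by
  have h3 := XY_Z _ h1 _ h2
  exact Finset.card_eq_three.2 ⟨_, _, _, XY_ne h1 h2, XZ_ne h1 h3, YZ_ne h2 h3, rfl⟩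

lemma tri_sum {p : GG × GG} (h1 : p.1 ∈ XX) (h2 : p.2 ∈ YY) : (tri p).sum id = 0 := by
  have h3 := XY_Z _ h1 _ h2
  rw [tri, Finset.sum_insert (by simp only [Finset.mem_insert, Finset.mem_singleton, not_or]; exact ⟨XY_ne h1 h2, XZ_ne h1 h3⟩),
    Finset.sum_insert (by simp only [Finset.mem_singleton]; exact YZ_ne h2 h3), Finset.sum_singleton]
  simp only [id]
  abel

lemma tri_disj {p q : GG × GG} (h1 : p.1 ∈ XX) (h2 : p.2 ∈ YY) (g1 : q.1 ∈ XX) (g2 : q.2 ∈ YY)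
    (ha : p.1 ≠ q.1) (hb : p.2 ≠ q.2) (hc : p.1 + p.2 ≠ q.1 + q.2) : Disjoint (tri p) (tri q) := by
  have h3 := XY_Z _ h1 _ h2
  have g3 := XY_Z _ g1 _ g2
  have hc' : -(p.1 + p.2) ≠ -(q.1 + q.2) := fun h => hc (neg_injective h)
  have := XY_ne h1 g2
  have := XY_ne g1 h2
  have := XZ_ne h1 g3
  have := XZ_ne g1 h3
  have := YZ_ne h2 g3
  have := YZ_ne g2 h3
  rw [Finset.disjoint_left]
  intro x hx hx'
  simp only [tri, Finset.mem_insert, Finset.mem_singleton] at hx hx'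
  rcases hx with rfl | rfl | rfl <;> rcases hx' with h | h | h <;>
    first | exact absurd h ‹_› | exact absurd h.symm ‹_›

lemma memX {p q : GG × GG} (h1 : p.1 ∈ XX) (h2 : p.2 ∈ YY) (g1 : q.1 ∈ XX) (g2 : q.2 ∈ YY) {x : GG}
    (hx : x ∈ ff (p, q)) :
    (x ∈ XX → x = p.1 ∨ x = q.1) ∧ (x ∈ YY → x = p.2 ∨ x = q.2) ∧
    (x ∈ ZZ → p.1 + p.2 = -x ∨ q.1 + q.2 = -x) := by
  have h3 := XY_Z _ h1 _ h2
  have g3 := XY_Z _ g1 _ g2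
  simp only [ff, tri, Finset.mem_union, Finset.mem_insert, Finset.mem_singleton] at hx
  refine ⟨fun h => ?_, fun h => ?_, fun h => ?_⟩
  · have := XY_ne h h2
    have := XY_ne h g2
    have := XZ_ne h h3
    have := XZ_ne h g3
    tauto
  · have := (XY_ne h1 h).symm
    have := (XY_ne g1 h).symm
    have := YZ_ne h h3
    have := YZ_ne h g3
    tauto
  · have := (XZ_ne h1 h).symm
    have := (XZ_ne g1 h).symm
    have := (YZ_ne h2 h).symm
    have := (YZ_ne g2 h).symm
    have : x = -(p.1 + p.2) ∨ x = -(q.1 + q.2) := by tauto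
    rcases this with rfl | rfl <;> simp


lemma ff_inj : Set.InjOn ff (SS : Set ((GG × GG) × (GG × GG))) := by
  rintro ⟨⟨a, b⟩, ⟨c, d⟩⟩ hp ⟨⟨a', b'⟩, ⟨c', d'⟩⟩ hq h
  simp only [SS, Finset.coe_filter, Finset.mem_product, Set.mem_ofPred_eq] at hp hq
  obtain ⟨⟨⟨ha, hb⟩, hc, hd⟩, hlt, hne, hs⟩ := hp
  obtain ⟨⟨⟨ha', hb'⟩, hc', hd'⟩, hlt', hne', hs'⟩ := hq
  have M := @memX (a', b') (c', d') ha' hb' hc' hd'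
  rw [← h] at M
  have Ma := (M (x := a) (by simp [ff, tri])).1 ha
  have Mc := (M (x := c) (by simp [ff, tri])).1 hc
  have Mb := (M (x := b) (by simp [ff, tri])).2.1 hb
  have Md := (M (x := d) (by simp [ff, tri])).2.1 hd
  have Me := (M (x := -(a + b)) (by simp [ff, tri])).2.2 (XY_Z _ ha _ hb)
  simp only [neg_neg] at Ma Mb Mc Md Me
  have hac : a = a' ∧ c = c' := by
    rcases Ma with rfl | rfl <;> rcases Mc with rfl | rfl <;> first | exact ⟨rfl, rfl⟩ | omega
  obtain ⟨rfl, rfl⟩ := hac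
  have hac : a ≠ c := by rintro rfl; omega
  have hbd : b = b' ∧ d = d' := by
    rcases Mb with rfl | rfl <;> rcases Md with rfl | rfl
    · exact absurd rfl hne
    · exact ⟨rfl, rfl⟩
    · exfalso
      rcases Me with h | h
      · exact hne (add_left_cancel h).symm
      · exact hac (add_right_cancel h).symm
    · exact absurd rfl hne
  obtain ⟨rfl, rfl⟩ := hbd
  rfl

theorem reducible_conics_count :
    ((OddPart.powersetCard 6).filter fun T =>
        (∃ h : ZMod 6 × ZMod 6, T.sum id = 3 • h) ∧
        ∃ A B : Finset (ZMod 6 × ZMod 6), A ∪ B = T ∧ Disjoint A B ∧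
          A.card = 3 ∧ B.card = 3 ∧ A.sum id = 0 ∧ B.sum id = 0).card = 2268 := by
  refine Eq.trans (congrArg Finset.card (a₂ := SS.image ff) ?_)
    ((Finset.card_image_of_injOn ff_inj).trans SS_card)
  ext T
  simp only [Finset.mem_filter, Finset.mem_powersetCard, Finset.mem_image]
  constructor
  · rintro ⟨⟨hT, -⟩, -, A, B, rfl, hd, hA, hB, sA, sB⟩
    obtain ⟨p, p1, p2, rfl⟩ := tri_of A (Finset.union_subset_left hT) hA sA
    obtain ⟨q, q1, q2, rfl⟩ := tri_of B (Finset.union_subset_right hT) hB sB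
    have n1 : p.1 ≠ q.1 := fun h =>
      Finset.disjoint_left.1 hd (show p.1 ∈ tri p by simp [tri]) (by simp [tri, h])
    have n2 : p.2 ≠ q.2 := fun h =>
      Finset.disjoint_left.1 hd (show p.2 ∈ tri p by simp [tri]) (by simp [tri, h])
    have n3 : p.1 + p.2 ≠ q.1 + q.2 := fun h =>
      Finset.disjoint_left.1 hd (show -(p.1 + p.2) ∈ tri p by simp only [tri]; simp)
        (by rw [h]; simp only [tri]; simp)
    rcases lt_trichotomy (kk p.1) (kk q.1) with h | h | h
    · exact ⟨(p, q), by
        simp only [SS, Finset.mem_filter, Finset.mem_product]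
        exact ⟨⟨⟨p1, p2⟩, q1, q2⟩, h, n2, n3⟩, rfl⟩
    · exact absurd (kk_inj _ _ h) n1
    · exact ⟨(q, p), by
        simp only [SS, Finset.mem_filter, Finset.mem_product]
        exact ⟨⟨⟨q1, q2⟩, p1, p2⟩, h, n2.symm, n3.symm⟩, Finset.union_comm _ _⟩
  · rintro ⟨⟨p, q⟩, hp, rfl⟩
    simp only [SS, Finset.mem_filter, Finset.mem_product] at hp
    obtain ⟨⟨⟨p1, p2⟩, q1, q2⟩, h, n2, n3⟩ := hp
    have n1 : p.1 ≠ q.1 := fun e => by rw [e] at h; omega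
    have hd := tri_disj p1 p2 q1 q2 n1 n2 n3
    refine ⟨⟨Finset.union_subset (tri_sub p1 p2) (tri_sub q1 q2), ?_⟩, ⟨0, ?_⟩,
      tri p, tri q, rfl, hd, tri_card p1 p2, tri_card q1 q2, tri_sum p1 p2, tri_sum q1 q2⟩
    · rw [ff, Finset.card_union_of_disjoint hd, tri_card p1 p2, tri_card q1 q2]
    · rw [ff, Finset.sum_union hd, tri_sum p1 p2, tri_sum q1 q2]; simp
end
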